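/- Let H₀ := [[0, 1+i],[1−i, 0]] ∈ ℂ^{2×2} (Hermitian). Then: (i) the complex second-order conic relaxation value inf{ Tr(H₀ Z) : Z ∈ ℂ^{2×2} Hermitian, Z₁₁ ≤ 1, Z₂₂ ≤ 1, Z₁₁ ≥ 0, Z₂₂ ≥ 0, |Z₁₂|² ≤ Z₁₁ Z₂₂ } equals −2√2; (ii) the real second-order conic relaxation value inf{ Tr(Λ(H₀) X) : X ∈ S₄, Tr(Λ(e₁e₁ᵀ) X) ≤ 1, Tr(Λ(e₂e₂ᵀ) X) ≤ 1, X_{ij}² ≤ X_{ii} X_{jj} for all 1 ≤ i ≠ j ≤ 4, X_{ii} ≥ 0 for i = 1,…,4 } equals −4. In particular, the complex second-order conic relaxation yields a strictly larger lower bound than the real one for this instance. -/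

import Mathlib

open scoped ComplexOrder
open Matrix

noncomputable section

/-- The ring homomorphism `Λ` sending a complex matrix `Z` to the real matrix
`[[Re Z, −Im Z],[Im Z, Re Z]]`. -/
def Lam {n : ℕ} (Z : Matrix (Fin n) (Fin n) ℂ) :
    Matrix (Fin n ⊕ Fin n) (Fin n ⊕ Fin n) ℝ :=
  Matrix.fromBlocks (Z.map Complex.re) (-(Z.map Complex.im))
    (Z.map Complex.im) (Z.map Complex.re)

/-- The objective matrix `H₀ = [[0, 1+i],[1−i, 0]]`. -/
def H0 : Matrix (Fin 2) (Fin 2) ℂ := !![0, 1 + Complex.I; 1 - Complex.I, 0]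

/-- Value of the complex second-order conic relaxation SOCP-ℂ for this instance. -/
def valSOCPC : ℝ :=
  sInf {r : ℝ | ∃ Z : Matrix (Fin 2) (Fin 2) ℂ, Z.IsHermitian ∧
    (Z 0 0).re ≤ 1 ∧ (Z 1 1).re ≤ 1 ∧ 0 ≤ (Z 0 0).re ∧ 0 ≤ (Z 1 1).re ∧
    Complex.normSq (Z 0 1) ≤ (Z 0 0).re * (Z 1 1).re ∧
    r = ((H0 * Z).trace).re}

/-- Value of the real second-order conic relaxation SOCP-ℝ for this instance. -/
def valSOCPR : ℝ :=
  sInf {r : ℝ | ∃ X : Matrix (Fin 2 ⊕ Fin 2) (Fin 2 ⊕ Fin 2) ℝ, X.IsSymm ∧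
    (Lam (Matrix.single (0 : Fin 2) (0 : Fin 2) (1 : ℂ)) * X).trace ≤ 1 ∧
    (Lam (Matrix.single (1 : Fin 2) (1 : Fin 2) (1 : ℂ)) * X).trace ≤ 1 ∧
    (∀ i j, i ≠ j → (X i j) ^ 2 ≤ X i i * X j j) ∧
    (∀ i, 0 ≤ X i i) ∧
    r = (Lam H0 * X).trace}

theorem trace_H0_mul_re (Z : Matrix (Fin 2) (Fin 2) ℂ) (hZ : Z.IsHermitian) :
    ((H0 * Z).trace).re = 2 * ((Z 0 1).re + (Z 0 1).im) := by
  have h : Z 1 0 = star (Z 0 1) := (hZ.apply 1 0).symm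
  simp [H0, Matrix.trace, Matrix.vecMul, dotProduct, Fin.sum_univ_two, h]
  ring

theorem trace_Lam_H0_mul (X : Matrix (Fin 2 ⊕ Fin 2) (Fin 2 ⊕ Fin 2) ℝ) (hX : X.IsSymm) :
    (Lam H0 * X).trace = 2 * (X (.inl 0) (.inl 1) + X (.inr 0) (.inr 1)
      - X (.inl 0) (.inr 1) + X (.inr 0) (.inl 1)) := by
  simp [Lam, H0, Matrix.trace, Matrix.mul_apply, Fin.sum_univ_two,
    hX.apply (.inl 0) (.inl 1), hX.apply (.inr 0) (.inr 1), hX.apply (.inl 0) (.inr 1),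
    hX.apply (.inr 0) (.inl 1)]
  ring

theorem trace_Lam_single_mul (k : Fin 2) (X : Matrix (Fin 2 ⊕ Fin 2) (Fin 2 ⊕ Fin 2) ℝ) :
    (Lam (Matrix.single k k (1 : ℂ)) * X).trace = X (.inl k) (.inl k) + X (.inr k) (.inr k) := by
  fin_cases k <;>
    simp [Lam, Matrix.trace, Matrix.mul_apply, Fin.sum_univ_two, Matrix.single_apply]

theorem two_mul_abs_le_add_of_sq_le_mul {x a b : ℝ} (ha : 0 ≤ a) (hb : 0 ≤ b)
    (h : x ^ 2 ≤ a * b) : 2 * |x| ≤ a + b := by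
  rw [← abs_two, ← abs_mul]
  exact abs_le_of_sq_le_sq (by nlinarith [sq_nonneg (a - b)]) (by positivity)

theorem isLeast_valSOCPC :
    IsLeast {r : ℝ | ∃ Z : Matrix (Fin 2) (Fin 2) ℂ, Z.IsHermitian ∧
      (Z 0 0).re ≤ 1 ∧ (Z 1 1).re ≤ 1 ∧ 0 ≤ (Z 0 0).re ∧ 0 ≤ (Z 1 1).re ∧
      Complex.normSq (Z 0 1) ≤ (Z 0 0).re * (Z 1 1).re ∧
      r = ((H0 * Z).trace).re} (-2 * Real.sqrt 2) := by
  have h2 : Real.sqrt 2 ^ 2 = 2 := Real.sq_sqrt zero_le_two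
  constructor
  · let z : ℂ := ⟨-(Real.sqrt 2 / 2), -(Real.sqrt 2 / 2)⟩
    have hZ : (!![1, z; star z, 1] : Matrix (Fin 2) (Fin 2) ℂ).IsHermitian := by
      ext i j
      fin_cases i <;> fin_cases j <;> simp
    refine ⟨!![1, z; star z, 1], hZ, by simp, by simp, by simp, by simp, ?_, ?_⟩
    · simp [Complex.normSq_apply, z]
      nlinarith
    · rw [trace_H0_mul_re _ hZ]
      simp [z]
      ring
  · rintro r ⟨Z, hZ, h0, h1, p0, p1, h, rfl⟩
    rw [trace_H0_mul_re Z hZ]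
    rw [Complex.normSq_apply] at h
    have hle : (Z 0 0).re * (Z 1 1).re ≤ 1 := mul_le_one₀ h0 p1 h1
    have := (abs_le_of_sq_le_sq (a := (Z 0 1).re + (Z 0 1).im) (b := Real.sqrt 2)
      (by nlinarith [sq_nonneg ((Z 0 1).re - (Z 0 1).im)]) (Real.sqrt_nonneg 2))
    linarith [neg_le_of_abs_le this]

theorem isLeast_valSOCPR :
    IsLeast {r : ℝ | ∃ X : Matrix (Fin 2 ⊕ Fin 2) (Fin 2 ⊕ Fin 2) ℝ, X.IsSymm ∧
      (Lam (Matrix.single (0 : Fin 2) (0 : Fin 2) (1 : ℂ)) * X).trace ≤ 1 ∧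
      (Lam (Matrix.single (1 : Fin 2) (1 : Fin 2) (1 : ℂ)) * X).trace ≤ 1 ∧
      (∀ i j, i ≠ j → (X i j) ^ 2 ≤ X i i * X j j) ∧
      (∀ i, 0 ≤ X i i) ∧
      r = (Lam H0 * X).trace} (-4) := by
  simp only [trace_Lam_single_mul]
  constructor
  · let A : Matrix (Fin 2) (Fin 2) ℝ := !![1 / 2, -1 / 2; -1 / 2, 1 / 2]
    let B : Matrix (Fin 2) (Fin 2) ℝ := !![0, 1 / 2; -1 / 2, 0]
    have hX : (Matrix.fromBlocks A B Bᵀ A).IsSymm := by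
      refine Matrix.IsSymm.fromBlocks ?_ rfl ?_ <;>
        exact Matrix.IsSymm.ext fun i j => by fin_cases i <;> fin_cases j <;> rfl
    refine ⟨Matrix.fromBlocks A B Bᵀ A, hX, ?_, ?_, ?_, ?_, ?_⟩
    · norm_num [A]
    · norm_num [A]
    · rintro (i | i) (j | j) - <;> fin_cases i <;> fin_cases j <;> norm_num [A, B]
    · rintro (i | i) <;> fin_cases i <;> norm_num [A]
    · rw [trace_Lam_H0_mul _ hX]
      norm_num [A, B]
  · rintro r ⟨X, hX, h0, h1, h, p, rfl⟩
    rw [trace_Lam_H0_mul X hX]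
    have key (i j) (hij : i ≠ j) : 2 * |X i j| ≤ X i i + X j j :=
      two_mul_abs_le_add_of_sq_le_mul (p i) (p j) (h i j hij)
    linarith [key (.inl 0) (.inl 1) (by simp), key (.inr 0) (.inr 1) (by simp),
      key (.inl 0) (.inr 1) (by simp), key (.inr 0) (.inl 1) (by simp),
      neg_abs_le (X (.inl 0) (.inl 1)), neg_abs_le (X (.inr 0) (.inr 1)),
      le_abs_self (X (.inl 0) (.inr 1)), neg_abs_le (X (.inr 0) (.inl 1))]

/-- For this instance, the complex SOCP relaxation has value `−2√2`, the real SOCP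
relaxation has value `−4`, and the complex bound is strictly larger. -/
theorem stmt3 :
    valSOCPC = -2 * Real.sqrt 2 ∧ valSOCPR = -4 ∧ valSOCPR < valSOCPC := by
  have hC : valSOCPC = -2 * Real.sqrt 2 := isLeast_valSOCPC.csInf_eq
  have hR : valSOCPR = -4 := isLeast_valSOCPR.csInf_eq
  refine ⟨hC, hR, ?_⟩
  rw [hC, hR]
  nlinarith [Real.sq_sqrt (zero_le_two : (0 : ℝ) ≤ 2), Real.sqrt_nonneg 2]
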